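/- Maximum spanning tree realizes widest path capacities: in a finite connected weighted undirected graph, for any maximum spanning tree T and vertices v, w, the minimum edge weight on the unique v–w path in T equals the widest path capacity between v and w in the whole graph. -/

import Mathlib

open scoped Classical in
/-- Total edge weight of a graph on a finite vertex type. -/
noncomputable def treeWeight {V : Type*} [Fintype V] (w : Sym2 V → ℝ) (H : SimpleGraph V) : ℝ :=
  ∑ e ∈ H.edgeFinset, w e

/-- A maximum spanning tree realizes widest path capacities: the minimum edge weight on
the (unique) path in the maximum spanning tree between two vertices is the greatest
element of the set of min-edge-weights over all walks between them in `G`. -/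
theorem max_spanning_tree_realizes_widest {V : Type*} [Fintype V] (G : SimpleGraph V)
    (w : Sym2 V → ℝ) (hw : ∀ e, 0 ≤ w e)
    (hG : G.Connected) (T : SimpleGraph V) (hTG : T ≤ G) (hT : T.IsTree)
    (hmax : ∀ T' : SimpleGraph V, T' ≤ G → T'.IsTree → treeWeight w T' ≤ treeWeight w T)
    (v u : V) (p : T.Walk v u) (hp : p.IsPath) :
    IsGreatest {m : WithTop ℝ | ∃ q : G.Walk v u, (q.edges.map w).minimum = m}
      ((p.edges.map w).minimum) := by
  classical
  refine ⟨⟨p.mapLe hTG, by simp⟩, ?_⟩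
  rintro m ⟨q, rfl⟩
  apply List.le_minimum_of_forall_le
  intro r hr
  obtain ⟨e, he, rfl⟩ := List.mem_map.1 hr
  have heT : e ∈ T.edgeSet := p.edges_subset_edgeSet he
  set T' := T.deleteEdges {e} with hT'
  have hle : T' ≤ T := T.deleteEdges_le {e}
  have hnr : ¬ T'.Reachable v u := by
    rintro ⟨p'⟩
    have h1 : (p'.bypass.mapLe hle).IsPath := (p'.bypass_isPath).mapLe hle
    have h2 : p'.bypass.mapLe hle = p :=
      congrArg Subtype.val (hT.isAcyclic.path_unique ⟨_, h1⟩ ⟨p, hp⟩)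
    rw [← h2] at he
    simp only [SimpleGraph.Walk.edges_mapLe_eq_edges] at he
    have := p'.bypass.edges_subset_edgeSet he
    simp [hT'] at this
  obtain ⟨d, hd, hx, hy⟩ := q.exists_boundary_dart {x | T'.Reachable v x}
    (SimpleGraph.Reachable.refl v) hnr
  have hxy : ¬ T'.Reachable d.fst d.snd := fun h => hy (SimpleGraph.Reachable.trans hx h)
  have hacy : (T' ⊔ SimpleGraph.edge d.fst d.snd).IsAcyclic :=
    SimpleGraph.IsAcyclic.sup_edge_of_not_reachable hxy (hT.isAcyclic.anti hle)
  have hG' : T' ⊔ SimpleGraph.edge d.fst d.snd ≤ G :=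
    sup_le (hle.trans hTG) ((SimpleGraph.edge_le_iff G).2 (Or.inr d.adj))
  obtain ⟨T3, h3, h3G, h3T⟩ := hG.exists_isTree_le_of_le_of_isAcyclic hG' hacy
  have hfT : s(d.fst, d.snd) ∉ T.edgeFinset.erase e := by
    intro h
    rw [Finset.mem_erase, SimpleGraph.mem_edgeFinset] at h
    apply hxy
    apply SimpleGraph.Adj.reachable
    rw [hT', SimpleGraph.deleteEdges_adj]
    exact ⟨h.2, h.1⟩
  have hsub : insert s(d.fst, d.snd) (T.edgeFinset.erase e) ⊆ T3.edgeFinset := by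
    intro f hf
    rw [SimpleGraph.mem_edgeFinset]
    rw [Finset.mem_insert, Finset.mem_erase, SimpleGraph.mem_edgeFinset] at hf
    apply SimpleGraph.edgeSet_mono h3
    rcases hf with rfl | hf
    · simp [SimpleGraph.edge_adj, d.adj.ne]
    · rw [SimpleGraph.edgeSet_sup]
      left
      rw [hT', SimpleGraph.edgeSet_deleteEdges]
      exact ⟨hf.2, hf.1⟩
  have hsum := Finset.sum_le_sum_of_subset_of_nonneg hsub (fun f _ _ => hw f)
  rw [Finset.sum_insert hfT] at hsum
  have herase := Finset.add_sum_erase T.edgeFinset w (SimpleGraph.mem_edgeFinset.2 heT)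
  have hm : ∑ f ∈ T3.edgeFinset, w f ≤ ∑ f ∈ T.edgeFinset, w f := by
    have := hmax T3 h3G h3T
    unfold treeWeight at this
    convert this
  have hfin : w s(d.fst, d.snd) ≤ w e := by linarith
  have hdq : s(d.fst, d.snd) ∈ q.edges := List.mem_map.2 ⟨d, hd, rfl⟩
  exact (List.minimum_le_of_mem' (List.mem_map_of_mem hdq)).trans (WithTop.coe_le_coe.2 hfin)
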